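/- arXiv:hep-th/0312001 — 2 statements merged into one kernel-verified Lean document; each statement's English description precedes it below -/
import Mathlib

section
/- Let U⁺, U⁻ ⊆ ℝⁿ be open and simply connected, and let ω_{ij} : U⁺ × U⁻ → ℝ (1 ≤ i, j ≤ n) be C^∞ functions satisfying ∂ω_{ij}/∂xᵏ = ∂ω_{kj}/∂xⁱ and ∂ω_{ij}/∂yᵏ = ∂ω_{ik}/∂yʲ on U⁺ × U⁻ for all i, j, k, where x are the first-factor variables and y the second-factor variables. Then there exists a C^∞ function K : U⁺ × U⁻ → ℝ such that ω_{ij} = ∂²K/∂xⁱ∂yʲ on U⁺ × U⁻ for all i, j. -/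
open Set Filter Topology MeasureTheory

/-- Local data `g i` on an open cover `V i` of a simply connected space, whose differences are
locally constant on overlaps, glue up to locally constant functions. -/
theorem exists_glue_of_simplyConnected {X ι A : Type*} [TopologicalSpace X]
    [SimplyConnectedSpace X] [LocallyPathConnectedSpace X] [AddCommGroup A]
    (V : ι → Set X) (hVo : ∀ i, IsOpen (V i)) (hV : ∀ x, ∃ i, x ∈ V i) (g : ι → X → A)
    (hg : ∀ i j, ∀ x ∈ V i ∩ V j, ∀ᶠ z in 𝓝 x, g i z - g j z = g i x - g j x) :
    ∃ f : X → A, ∀ i, ∀ x ∈ V i, ∀ᶠ z in 𝓝 x, f z - g i z = f x - g i x := by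
  let : TopologicalSpace A := ⊥
  have : DiscreteTopology A := ⟨rfl⟩
  choose idx hidx using hV
  let Z : FiberBundleCore ι X A :=
    { baseSet := V
      isOpen_baseSet := hVo
      indexAt := idx
      mem_baseSet_at := hidx
      coordChange := fun i j x v => v + (g i x - g j x)
      coordChange_self := by simp
      continuousOn_coordChange := by
        rintro i j ⟨x, v⟩ ⟨hx, -⟩
        apply ContinuousAt.continuousWithinAt
        refine continuousAt_snd.add ?_
        refine ContinuousAt.comp (f := Prod.fst) (g := fun z => g i z - g j z) ?_ continuousAt_fst
        exact continuousAt_const.congr ((hg i j x hx).mono fun z hz => hz.symm)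
      coordChange_comp := by
        intro i j k x _ v
        abel }
  have hcov : IsCoveringMap (Bundle.TotalSpace.proj : Bundle.TotalSpace A Z.Fiber → X) :=
    IsFiberBundle.isCoveringMap (F := A) fun x => ⟨Z.localTrivAt x, Z.mem_localTrivAt_baseSet x⟩
  obtain ⟨x₀⟩ : Nonempty X := inferInstance
  obtain ⟨s, ⟨-, hs⟩, -⟩ := hcov.existsUnique_continuousMap_lifts (ContinuousMap.id X) x₀
    (⟨x₀, (0 : A)⟩ : Bundle.TotalSpace A Z.Fiber) rfl
  have hs' : ∀ x, (s x).proj = x := fun x => congrFun hs x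
  let v : X → A := fun x => (s x).2
  refine ⟨fun x => v x + g (idx x) x, fun i x hx => ?_⟩
  have hsrc : s x ∈ (Z.localTriv i).source := by
    rw [Z.mem_localTriv_source, ← Z.baseSet_at, hs']
    exact hx
  have hc : ContinuousAt (fun z => (Z.localTriv i (s z)).2) x :=
    continuousAt_snd.comp
      (((Z.localTriv i).continuousOn_toFun.continuousAt
        ((Z.localTriv i).open_source.mem_nhds hsrc)).comp s.continuous.continuousAt)
  have hev := hc.eventually_mem (isOpen_discrete {(Z.localTriv i (s x)).2} |>.mem_nhds rfl)
  have key : ∀ z, (Z.localTriv i (s z)).2 = v z + g (idx z) z - g i z := by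
    intro z
    rw [Z.localTriv_apply]
    change v z + (g (idx (s z).proj) (s z).proj - g i (s z).proj) = _
    rw [hs', add_sub_assoc]
  filter_upwards [hev] with z hz
  rw [mem_singleton_iff, key, key] at hz
  exact hz

/-- Smoothness of a parametric interval integral over `[0, 1]`. -/
theorem contDiffOn_intervalIntegral_param {P : Type*} [NormedAddCommGroup P] [NormedSpace ℝ P]
    {s : Set P} (hs : IsOpen s) {h : P × ℝ → ℝ}
    (hh : ContDiffOn ℝ (⊤ : ℕ∞) h (s ×ˢ Metric.ball 0 2)) :
    ContDiffOn ℝ (⊤ : ℕ∞) (fun p => ∫ t in (0 : ℝ)..1, h (p, t)) s := by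
  let χ : ContDiffBump (0 : ℝ) := ⟨1, 3 / 2, by norm_num, by norm_num⟩
  let g : P → ℝ → ℝ := fun p t => χ (-t) * h (p, -t)
  let f : ℝ → ℝ := (Ioc (0 : ℝ) 1).indicator 1
  have hf : LocallyIntegrable f volume :=
    ((integrable_indicator_iff measurableSet_Ioc).2
      (integrableOn_const (by simp))).locallyIntegrable
  have hsupp : ∀ t : ℝ, t ∉ Metric.closedBall (0 : ℝ) (3 / 2) → χ (-t) = 0 := by
    intro t ht
    apply χ.zero_of_le_dist
    simp only [Metric.mem_closedBall, dist_zero_right, not_le, norm_neg] at ht ⊢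
    exact ht.le
  have hg : ContDiffOn ℝ (⊤ : ℕ∞) ↿g (s ×ˢ univ) := by
    rintro ⟨p, t⟩ ⟨hp, -⟩
    apply ContDiffAt.contDiffWithinAt
    by_cases ht : t ∈ Metric.closedBall (0 : ℝ) (3 / 2)
    · have h1 : ContDiffAt ℝ (⊤ : ℕ∞) h (p, -t) := by
        refine hh.contDiffAt ((hs.prod Metric.isOpen_ball).mem_nhds ⟨hp, ?_⟩)
        simp only [Metric.mem_closedBall, dist_zero_right, Metric.mem_ball, norm_neg] at ht ⊢
        linarith
      have h2 : ContDiffAt ℝ (⊤ : ℕ∞) (fun q : P × ℝ => (q.1, -q.2)) (p, t) := by fun_prop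
      have h3 : ContDiffAt ℝ (⊤ : ℕ∞) (fun q : P × ℝ => χ (-q.2)) (p, t) :=
        χ.contDiff.contDiffAt.comp (p, t) (contDiff_snd.neg.contDiffAt)
      exact h3.mul (ContDiffAt.comp (p, t) (g := h) h1 h2)
    · have : ∀ᶠ q : P × ℝ in 𝓝 (p, t), ↿g q = 0 := by
        have := continuousAt_snd.eventually_mem
          (x := (p, t)) (Metric.isClosed_closedBall.isOpen_compl.mem_nhds ht)
        filter_upwards [this] with q hq
        change χ (-q.2) * _ = 0
        rw [hsupp _ hq, zero_mul]
      exact contDiffAt_const.congr_of_eventuallyEq this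
  have main := contDiffOn_convolution_right_with_param (μ := volume)
    (ContinuousLinearMap.mul ℝ ℝ) hs (isCompact_closedBall (0 : ℝ) (3 / 2))
    (g := g) (fun p t _ ht => by simp [g, hsupp t ht]) hf hg
  have hpair : ContDiffOn ℝ (⊤ : ℕ∞) (fun p : P => (p, (0 : ℝ))) s := by fun_prop
  refine (main.comp hpair fun p hp => ⟨hp, mem_univ _⟩).congr fun p hp => ?_
  simp only [Function.comp, convolution_def, ContinuousLinearMap.mul_apply']
  rw [intervalIntegral.integral_of_le zero_le_one, ← integral_indicator measurableSet_Ioc]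
  refine integral_congr_ae (Eventually.of_forall fun t => ?_)
  by_cases ht : t ∈ Ioc (0 : ℝ) 1
  · have : χ t = 1 := χ.one_of_mem_closedBall (by
      simp only [Metric.mem_closedBall, dist_zero_right, Real.norm_eq_abs, abs_of_pos ht.1]
      exact ht.2)
    simp [f, g, ht, this]
  · simp [f, ht]

/-- The Poincaré lemma on a ball with smooth parameters, by integration along rays. -/
theorem exists_partial_primitive_ball {E G : Type*} [NormedAddCommGroup E] [NormedSpace ℝ E]
    [NormedAddCommGroup G] [NormedSpace ℝ G] {a : E} {r : ℝ} {W : Set G} (hW : IsOpen W)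
    {α : E × G → E →L[ℝ] ℝ} (hα : ContDiffOn ℝ (⊤ : ℕ∞) α (Metric.ball a (2 * r) ×ˢ W))
    (hsymm : ∀ p ∈ Metric.ball a (2 * r) ×ˢ W, ∀ u v,
      fderiv ℝ α p (u, 0) v = fderiv ℝ α p (v, 0) u) :
    ∃ g : E × G → ℝ, ContDiffOn ℝ (⊤ : ℕ∞) g (Metric.ball a r ×ˢ W) ∧
      ∀ x ∈ Metric.ball a r, ∀ y ∈ W, HasFDerivAt (fun z => g (z, y)) (α (x, y)) x := by
  have hsub : Metric.ball a r ⊆ Metric.ball a (2 * r) := by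
    intro x hx
    have := Metric.pos_of_mem_ball hx
    exact Metric.ball_subset_ball (by linarith) hx
  refine ⟨fun p => ∫ t in (0 : ℝ)..1, α (AffineMap.lineMap a p.1 t, p.2) (p.1 - a), ?_, ?_⟩
  · have hline : ContDiff ℝ (⊤ : ℕ∞)
        fun q : (E × G) × ℝ => (AffineMap.lineMap a q.1.1 q.2, q.1.2) := by
      simp only [AffineMap.lineMap_apply_module']
      fun_prop
    have hmaps : MapsTo (fun q : (E × G) × ℝ => (AffineMap.lineMap a q.1.1 q.2, q.1.2))
        ((Metric.ball a r ×ˢ W) ×ˢ Metric.ball 0 2) (Metric.ball a (2 * r) ×ˢ W) := by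
      rintro ⟨⟨x, y⟩, t⟩ ⟨⟨hx, hy⟩, ht⟩
      refine ⟨?_, hy⟩
      simp only [Metric.mem_ball, dist_zero_right, dist_lineMap_left] at hx ht ⊢
      rw [dist_comm] at hx
      have := dist_nonneg (x := a) (y := x)
      nlinarith [norm_nonneg t]
    have h1 := hα.comp hline.contDiffOn hmaps
    have h2 : ContDiff ℝ (⊤ : ℕ∞) fun q : (E × G) × ℝ => q.1.1 - a := by fun_prop
    exact contDiffOn_intervalIntegral_param (Metric.isOpen_ball.prod hW)
      (h1.clm_apply h2.contDiffOn)
  · intro x hx y hy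
    have hd : ∀ z ∈ Metric.ball a r, HasFDerivWithinAt (fun z => α (z, y))
        ((fderiv ℝ α (z, y)).comp (ContinuousLinearMap.inl ℝ E G)) (Metric.ball a r) z := by
      intro z hz
      have h1 : DifferentiableAt ℝ α (z, y) :=
        (hα.contDiffAt ((Metric.isOpen_ball.prod hW).mem_nhds ⟨hsub hz, hy⟩)).differentiableAt
          (by simp)
      exact (h1.hasFDerivAt.comp z (hasFDerivAt_prodMk_left z y)).hasFDerivWithinAt
    have key := Convex.hasFDerivWithinAt_curveIntegral_segment_of_hasFDerivWithinAt_symmetric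
      (convex_ball a r) hd (fun z hz u _ v _ => by simpa using hsymm (z, y) ⟨hsub hz, hy⟩ u v)
      (Metric.mem_ball_self (Metric.pos_of_mem_ball hx)) hx
    simpa only [curveIntegral_segment] using
      key.hasFDerivAt (Metric.isOpen_ball.mem_nhds hx)

/-- The Poincaré lemma with smooth parameters, for one-forms on a simply connected open set. -/
theorem exists_partial_primitive {E G : Type*} [NormedAddCommGroup E] [NormedSpace ℝ E]
    [NormedAddCommGroup G] [NormedSpace ℝ G] {U : Set E} (hU : IsOpen U)
    [SimplyConnectedSpace U] {W : Set G} (hW : IsOpen W)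
    {α : E × G → E →L[ℝ] ℝ} (hα : ContDiffOn ℝ (⊤ : ℕ∞) α (U ×ˢ W))
    (hsymm : ∀ p ∈ U ×ˢ W, ∀ u v, fderiv ℝ α p (u, 0) v = fderiv ℝ α p (v, 0) u) :
    ∃ f : E × G → ℝ, ContDiffOn ℝ (⊤ : ℕ∞) f (U ×ˢ W) ∧
      ∀ p ∈ U ×ˢ W, ∀ v, fderiv ℝ f p (v, 0) = α p v := by
  classical
  have hex : ∀ a : U, ∃ r : ℝ, 0 < r ∧ ∃ g : E × G → ℝ,
      ContDiffOn ℝ (⊤ : ℕ∞) g (Metric.ball (a : E) r ×ˢ W) ∧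
      ∀ x ∈ Metric.ball (a : E) r, ∀ y ∈ W, HasFDerivAt (fun z => g (z, y)) (α (x, y)) x := by
    intro a
    obtain ⟨ε, hε, hεU⟩ := Metric.isOpen_iff.1 hU a a.2
    have hball : Metric.ball (a : E) (2 * (ε / 2)) ⊆ U := by rwa [mul_div_cancel₀ _ two_ne_zero]
    obtain ⟨g, hg, hg'⟩ := exists_partial_primitive_ball hW
      (hα.mono (prod_mono_left hball)) (fun p hp => hsymm p ⟨hball hp.1, hp.2⟩)
    exact ⟨ε / 2, half_pos hε, g, hg, hg'⟩
  choose r hr g hg hg' using hex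
  let S : AddSubgroup (W → ℝ) :=
    { carrier := {h | ∃ k : G → ℝ, ContDiffOn ℝ (⊤ : ℕ∞) k W ∧ ∀ y : W, h y = k y}
      zero_mem' := ⟨0, contDiffOn_const, fun _ => rfl⟩
      add_mem' := by
        rintro h₁ h₂ ⟨k₁, hk₁, e₁⟩ ⟨k₂, hk₂, e₂⟩
        exact ⟨k₁ + k₂, hk₁.add hk₂, fun y => by simp [e₁, e₂]⟩
      neg_mem' := by
        rintro h₁ ⟨k₁, hk₁, e₁⟩
        exact ⟨-k₁, hk₁.neg, fun y => by simp [e₁]⟩ }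
  let V : U → Set U := fun a => Subtype.val ⁻¹' Metric.ball (a : E) (r a)
  let γ : U → U → S := fun a x =>
    if hx : x ∈ V a then
      ⟨fun y => g a (x, y), fun y => g a (x, y),
        (hg a).comp (by fun_prop) fun y hy => ⟨hx, hy⟩, fun _ => rfl⟩
    else 0
  have hγ : ∀ a x, x ∈ V a → ∀ y : W, (γ a x : W → ℝ) y = g a (x, y) := by
    intro a x hx y
    simp only [γ, dif_pos hx]
  have hVo : ∀ a, IsOpen (V a) := fun a => Metric.isOpen_ball.preimage continuous_subtype_val
  have : LocallyPathConnectedSpace U := hU.locallyPathConnectedSpace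
  obtain ⟨f, hf⟩ := exists_glue_of_simplyConnected V hVo
    (fun x => ⟨x, Metric.mem_ball_self (hr x)⟩) γ (by
      rintro a b x ⟨hxa, hxb⟩
      filter_upwards [(hVo a).mem_nhds hxa, (hVo b).mem_nhds hxb] with z hza hzb
      ext y
      have hconst := (Metric.isOpen_ball.inter Metric.isOpen_ball).is_const_of_fderiv_eq_zero
        ((convex_ball (a : E) (r a)).inter (convex_ball (b : E) (r b))).isPreconnected
        (f := fun x => g a (x, y) - g b (x, y)) (𝕜 := ℝ)
        (fun w hw => ((hg' a w hw.1 y y.2).sub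
          (hg' b w hw.2 y y.2)).differentiableAt.differentiableWithinAt)
        (fun w hw => by
          have := ((hg' a w hw.1 y y.2).sub (hg' b w hw.2 y y.2)).fderiv
          rwa [sub_self] at this) ⟨hza, hzb⟩ ⟨hxa, hxb⟩
      simpa [hγ, hza, hzb, hxa, hxb] using hconst)
  let F : E × G → ℝ := fun p =>
    if h : p.1 ∈ U ∧ p.2 ∈ W then (f ⟨p.1, h.1⟩ : W → ℝ) ⟨p.2, h.2⟩ else 0
  have hloc : ∀ x (hx : x ∈ U), ∃ k : G → ℝ, ContDiffOn ℝ (⊤ : ℕ∞) k W ∧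
      ∀ᶠ z in 𝓝 x, ∀ y ∈ W, F (z, y) = g ⟨x, hx⟩ (z, y) + k y := by
    intro x hx
    have hxV : (⟨x, hx⟩ : U) ∈ V ⟨x, hx⟩ := Metric.mem_ball_self (hr _)
    obtain ⟨k, hk, hk'⟩ := (f ⟨x, hx⟩ - γ ⟨x, hx⟩ ⟨x, hx⟩).2
    refine ⟨k, hk, ?_⟩
    have hev := (hf _ _ hxV).and ((hVo _).mem_nhds hxV)
    rw [← hU.isOpenEmbedding_subtypeVal.map_nhds_eq ⟨x, hx⟩]
    refine Filter.eventually_map.2 ?_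
    filter_upwards [hev] with z hz y hy
    have h1 := congrFun (congrArg Subtype.val hz.1) ⟨y, hy⟩
    rw [hk' ⟨y, hy⟩] at h1
    have h2 := hγ ⟨x, hx⟩ z hz.2 ⟨y, hy⟩
    have h3 : F (z, y) = (f z : W → ℝ) ⟨y, hy⟩ := by
      simp only [F, dif_pos (And.intro z.2 hy)]
    rw [h3, ← h1, ← h2]
    simp
  have hFs : ContDiffOn ℝ (⊤ : ℕ∞) F (U ×ˢ W) := by
    rintro ⟨x, y⟩ ⟨hx, hy⟩
    obtain ⟨k, hk, hFk⟩ := hloc x hx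
    have h1 : ContDiffAt ℝ (⊤ : ℕ∞) (g ⟨x, hx⟩) (x, y) :=
      (hg ⟨x, hx⟩).contDiffAt ((Metric.isOpen_ball.prod hW).mem_nhds
        ⟨Metric.mem_ball_self (hr _), hy⟩)
    have h2 : ContDiffAt ℝ (⊤ : ℕ∞) (fun q : E × G => k q.2) (x, y) :=
      (hk.contDiffAt (hW.mem_nhds hy)).comp (x, y) contDiffAt_snd
    refine ((h1.add h2).congr_of_eventuallyEq ?_).contDiffWithinAt
    rw [nhds_prod_eq]
    filter_upwards [hFk.prod_mk (hW.mem_nhds hy)] with q hq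
    exact hq.1 _ hq.2
  refine ⟨F, hFs, ?_⟩
  rintro ⟨x, y⟩ ⟨hx, hy⟩ v
  obtain ⟨k, hk, hFk⟩ := hloc x hx
  have h1 : HasFDerivAt (fun z => F (z, y)) (α (x, y)) x :=
    ((hg' ⟨x, hx⟩ x (Metric.mem_ball_self (hr _)) y hy).add_const (k y)).congr_of_eventuallyEq
      (hFk.mono fun z hz => hz y hy)
  have h2 : DifferentiableAt ℝ F (x, y) :=
    (hFs.contDiffAt ((hU.prod hW).mem_nhds ⟨hx, hy⟩)).differentiableAt (by simp)
  have h3 := HasFDerivAt.comp (f := fun z => (z, y)) x h2.hasFDerivAt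
    (hasFDerivAt_prodMk_left x y)
  simpa using (DFunLike.congr_fun (h1.unique h3) v).symm

/-- Coordinate form of the Poincaré lemma with smooth parameters. -/
theorem exists_partial_primitive_coord {ι G : Type*} [Fintype ι] [DecidableEq ι]
    [NormedAddCommGroup G] [NormedSpace ℝ G] {U : Set (ι → ℝ)} (hU : IsOpen U)
    [SimplyConnectedSpace U] {W : Set G} (hW : IsOpen W) {a : ι → (ι → ℝ) × G → ℝ}
    (ha : ∀ i, ContDiffOn ℝ (⊤ : ℕ∞) (a i) (U ×ˢ W))
    (hsymm : ∀ i k, ∀ p ∈ U ×ˢ W,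
      fderiv ℝ (a i) p (Pi.single k 1, 0) = fderiv ℝ (a k) p (Pi.single i 1, 0)) :
    ∃ f : (ι → ℝ) × G → ℝ, ContDiffOn ℝ (⊤ : ℕ∞) f (U ×ˢ W) ∧
      ∀ p ∈ U ×ˢ W, ∀ i, fderiv ℝ f p (Pi.single i 1, 0) = a i p := by
  let α : (ι → ℝ) × G → (ι → ℝ) →L[ℝ] ℝ := fun p =>
    ∑ i, a i p • ContinuousLinearMap.proj (R := ℝ) (φ := fun _ : ι => ℝ) i
  have hα : ContDiffOn ℝ (⊤ : ℕ∞) α (U ×ˢ W) :=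
    ContDiffOn.sum fun i _ => (ha i).smul contDiffOn_const
  have hdα : ∀ p ∈ U ×ˢ W, ∀ (u : (ι → ℝ) × G) (v : ι → ℝ),
      fderiv ℝ α p u v = ∑ i, fderiv ℝ (a i) p u * v i := by
    intro p hp u v
    have h : HasFDerivAt α (∑ i, (fderiv ℝ (a i) p).smulRight
        (ContinuousLinearMap.proj (R := ℝ) (φ := fun _ : ι => ℝ) i)) p := by
      refine HasFDerivAt.fun_sum fun i _ => ?_
      have h : DifferentiableAt ℝ (a i) p :=
        ((ha i).contDiffAt ((hU.prod hW).mem_nhds hp)).differentiableAt (by simp)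
      exact h.hasFDerivAt.smul_const
        (ContinuousLinearMap.proj (R := ℝ) (φ := fun _ : ι => ℝ) i)
    simp [h.fderiv]
  have hvec : ∀ (L : (ι → ℝ) × G →L[ℝ] ℝ) (u : ι → ℝ),
      L (u, 0) = ∑ k, u k * L (Pi.single k 1, 0) := by
    intro L u
    have := map_sum (L.comp (ContinuousLinearMap.inl ℝ (ι → ℝ) G))
      (fun k => u k • Pi.single k (1 : ℝ)) Finset.univ
    rw [← pi_eq_sum_univ' u] at this
    simpa only [map_smul, ContinuousLinearMap.comp_apply, ContinuousLinearMap.inl_apply,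
      smul_eq_mul] using this
  obtain ⟨f, hf, hf'⟩ := exists_partial_primitive hU hW hα (by
    intro p hp u v
    rw [hdα p hp, hdα p hp]
    simp only [hvec _ u, hvec _ v, Finset.sum_mul]
    rw [Finset.sum_comm]
    refine Finset.sum_congr rfl fun k _ => Finset.sum_congr rfl fun i _ => ?_
    rw [hsymm i k p hp]
    ring)
  refine ⟨f, hf, fun p hp i => ?_⟩
  rw [hf' p hp]
  simp [α, Pi.single_apply]

/-- Mixed second directional derivatives of a smooth function commute. -/
theorem fderiv_fderiv_apply_comm {E : Type*} [NormedAddCommGroup E] [NormedSpace ℝ E]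
    {f : E → ℝ} {p : E} (hf : ContDiffAt ℝ (⊤ : ℕ∞) f p) (u v : E) :
    fderiv ℝ (fun q => fderiv ℝ f q u) p v = fderiv ℝ (fun q => fderiv ℝ f q v) p u := by
  have hd : DifferentiableAt ℝ (fderiv ℝ f) p :=
    (hf.fderiv_right (m := 1) (by norm_cast)).differentiableAt (by simp)
  rw [fderiv_clm_apply hd (differentiableAt_const u),
    fderiv_clm_apply hd (differentiableAt_const v)]
  simpa using hf.isSymmSndFDerivAt (by simp; norm_cast) v u

/-- Existence part of the para-Kähler potential theorem in adapted coordinates: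
given smooth coefficients `ω_{ij}` on `U⁺ × U⁻` (both factors open and simply
connected in `ℝⁿ`) whose `x`-derivatives are symmetric in `(i,k)` and whose
`y`-derivatives are symmetric in `(j,k)` (i.e. the two-form
`Σ ω_{ij} dz₊ⁱ ∧ dz₋ʲ` is closed), there exists a smooth potential `K` with
`∂²K/∂xⁱ∂yʲ = ω_{ij}`. -/
theorem stmt_9 (n : ℕ) (Uplus Uminus : Set (Fin n → ℝ))
    (hUp : IsOpen Uplus) (hUm : IsOpen Uminus)
    (hUpSC : SimplyConnectedSpace Uplus) (hUmSC : SimplyConnectedSpace Uminus)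
    (ω : Fin n → Fin n → ((Fin n → ℝ) × (Fin n → ℝ)) → ℝ)
    (hω : ∀ i j, ContDiffOn ℝ (⊤ : ℕ∞) (ω i j) (Uplus ×ˢ Uminus))
    (hx : ∀ i j k : Fin n, ∀ p ∈ Uplus ×ˢ Uminus,
      fderiv ℝ (ω i j) p (Pi.single k 1, 0) = fderiv ℝ (ω k j) p (Pi.single i 1, 0))
    (hy : ∀ i j k : Fin n, ∀ p ∈ Uplus ×ˢ Uminus,
      fderiv ℝ (ω i j) p (0, Pi.single k 1) = fderiv ℝ (ω i k) p (0, Pi.single j 1)) :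
    ∃ K : ((Fin n → ℝ) × (Fin n → ℝ)) → ℝ,
      ContDiffOn ℝ (⊤ : ℕ∞) K (Uplus ×ˢ Uminus) ∧
      ∀ i j : Fin n, ∀ p ∈ Uplus ×ˢ Uminus,
        fderiv ℝ (fun q => fderiv ℝ K q (Pi.single i 1, 0)) p (0, Pi.single j 1) =
          ω i j p := by
  have hO : IsOpen (Uplus ×ˢ Uminus) := hUp.prod hUm
  choose φ hφ hφω using fun j => exists_partial_primitive_coord hUp hUm
    (fun i => hω i j) (fun i k p hp => hx i j k p hp)
  obtain ⟨x₀, hx₀⟩ : Uplus.Nonempty := nonempty_coe_sort.1 inferInstance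
  have hconn : IsPreconnected Uplus :=
    isPreconnected_iff_preconnectedSpace.2 inferInstance
  -- the potentials of the rows, normalized to vanish on `{x₀} × Uminus`
  let β : Fin n → (Fin n → ℝ) × (Fin n → ℝ) → ℝ := fun j p => φ j p - φ j (x₀, p.2)
  let e : (Fin n → ℝ) × (Fin n → ℝ) → (Fin n → ℝ) × (Fin n → ℝ) := fun p => (x₀, p.2)
  have he : ∀ p, HasFDerivAt e ((ContinuousLinearMap.inr ℝ (Fin n → ℝ) (Fin n → ℝ)).comp
      (ContinuousLinearMap.snd ℝ (Fin n → ℝ) (Fin n → ℝ))) p := fun p =>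
    (hasFDerivAt_prodMk_right x₀ p.2).comp p hasFDerivAt_snd
  have hemaps : MapsTo e (Uplus ×ˢ Uminus) (Uplus ×ˢ Uminus) := fun p hp => ⟨hx₀, hp.2⟩
  have hβ : ∀ j, ContDiffOn ℝ (⊤ : ℕ∞) (β j) (Uplus ×ˢ Uminus) := fun j =>
    (hφ j).sub ((hφ j).comp (by fun_prop) hemaps)
  have hφd : ∀ j, ∀ p ∈ Uplus ×ˢ Uminus, DifferentiableAt ℝ (φ j) p := fun j p hp =>
    ((hφ j).contDiffAt (hO.mem_nhds hp)).differentiableAt (by simp)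
  have hβd : ∀ j, ∀ p ∈ Uplus ×ˢ Uminus, ∀ u,
      fderiv ℝ (β j) p u = fderiv ℝ (φ j) p u - fderiv ℝ (φ j) (x₀, p.2) (0, u.2) := by
    intro j p hp u
    have h : HasFDerivAt (β j) _ p := (hφd j p hp).hasFDerivAt.sub
      (HasFDerivAt.comp (f := e) p (hφd j _ (hemaps hp)).hasFDerivAt (he p))
    rw [h.fderiv]
    rfl
  have hβω : ∀ i j, ∀ p ∈ Uplus ×ˢ Uminus, fderiv ℝ (β j) p (Pi.single i 1, 0) = ω i j p := by
    intro i j p hp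
    rw [hβd j p hp, hφω j p hp]
    exact sub_eq_self.2 (map_zero _)
  -- the row potentials are closed along the second factor
  have hβy : ∀ j k, ∀ p ∈ Uplus ×ˢ Uminus,
      fderiv ℝ (β j) p (0, Pi.single k 1) = fderiv ℝ (β k) p (0, Pi.single j 1) := by
    rintro j k ⟨x, y⟩ ⟨hxU, hyU⟩
    have hdd : ∀ j, ∀ p ∈ Uplus ×ˢ Uminus, ∀ v,
        DifferentiableAt ℝ (fun q => fderiv ℝ (β j) q v) p := fun j p hp v =>
      ((((hβ j).contDiffAt (hO.mem_nhds hp)).fderiv_right (m := 1)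
        (by norm_cast)).differentiableAt (by simp)).clm_apply (differentiableAt_const v)
    let D : (Fin n → ℝ) × (Fin n → ℝ) → ℝ := fun q =>
      fderiv ℝ (β j) q (0, Pi.single k 1) - fderiv ℝ (β k) q (0, Pi.single j 1)
    have hD : ∀ z ∈ Uplus, HasFDerivAt (fun z => D (z, y)) (0 : (Fin n → ℝ) →L[ℝ] ℝ) z := by
      intro z hz
      have hp : (z, y) ∈ Uplus ×ˢ Uminus := ⟨hz, hyU⟩
      have hDd := (hdd j _ hp (0, Pi.single k 1)).hasFDerivAt.sub
        (hdd k _ hp (0, Pi.single j 1)).hasFDerivAt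
      refine (HasFDerivAt.comp (g := D) (f := fun z => (z, y)) z hDd
        (hasFDerivAt_prodMk_left z y)).congr_fderiv ?_
      refine ContinuousLinearMap.coe_injective (LinearMap.pi_ext' fun i => ?_)
      ext
      have hωd : ∀ j k, fderiv ℝ (fun q => fderiv ℝ (β j) q (0, Pi.single k 1)) (z, y)
          (Pi.single i 1, 0) = fderiv ℝ (ω i j) (z, y) (0, Pi.single k 1) := by
        intro j k
        rw [fderiv_fderiv_apply_comm ((hβ j).contDiffAt (hO.mem_nhds hp))]
        refine DFunLike.congr_fun (Filter.EventuallyEq.fderiv_eq ?_) _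
        filter_upwards [hO.mem_nhds hp] with q hq using hβω i j q hq
      simp [hωd, hy i j k _ hp]
    have hconst := hUp.is_const_of_fderiv_eq_zero hconn
      (fun z hz => (hD z hz).differentiableAt.differentiableWithinAt)
      (fun z hz => (hD z hz).fderiv) hxU hx₀
    have h0 : D (x₀, y) = 0 := by
      simp [D, hβd _ _ (show (x₀, y) ∈ Uplus ×ˢ Uminus from ⟨hx₀, hyU⟩)]
    exact sub_eq_zero.1 (hconst.trans h0)
  have hswap : ∀ (f : (Fin n → ℝ) × (Fin n → ℝ) → ℝ) (p u : (Fin n → ℝ) × (Fin n → ℝ)),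
      fderiv ℝ (fun q => f q.swap) p u = fderiv ℝ f p.swap u.swap := fun f p u =>
    DFunLike.congr_fun ((ContinuousLinearEquiv.prodComm ℝ (Fin n → ℝ)
      (Fin n → ℝ)).comp_right_fderiv (f := f) (x := p)) u
  obtain ⟨f, hf, hfβ⟩ := exists_partial_primitive_coord hUm hUp
    (a := fun j q => β j q.swap)
    (fun j => (hβ j).comp (contDiff_snd.prodMk contDiff_fst).contDiffOn fun q hq => ⟨hq.2, hq.1⟩)
    (fun j k q hq => by
      rw [hswap, hswap]
      exact hβy j k _ ⟨hq.2, hq.1⟩)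
  have hK : ContDiffOn ℝ (⊤ : ℕ∞) (fun q => f q.swap) (Uplus ×ˢ Uminus) :=
    hf.comp (contDiff_snd.prodMk contDiff_fst).contDiffOn fun q hq => ⟨hq.2, hq.1⟩
  refine ⟨fun q => f q.swap, hK, fun i j p hp => ?_⟩
  rw [fderiv_fderiv_apply_comm (hK.contDiffAt (hO.mem_nhds hp)), ← hβω i j p hp]
  refine DFunLike.congr_fun (Filter.EventuallyEq.fderiv_eq ?_) _
  filter_upwards [hO.mem_nhds hp] with q hq
  rw [hswap]
  exact hfβ _ ⟨hq.2, hq.1⟩ j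
end

section
/- Let t ∈ ℕ and σ ∈ {+1, −1}, and let A, C be invertible complex N×N matrices with A† = (−1)^{t(t+1)/2}·A and Cᵀ = σ·C. Set B := (C A⁻¹)ᵀ and assume B̄·B = −1 (where bar denotes entrywise complex conjugation), i.e. λ ↦ −B̄λ̄ is a quaternionic structure. Then B†·C·B̄ = −σ·(−1)^{t(t+1)/2} · C̄. -/
open Matrix

/-- If `A† = (−1)^{t(t+1)/2} A`, `Cᵀ = σC`, `B := (CA⁻¹)ᵀ` and `B̄B = −1`
(so that `λ ↦ −B̄λ̄` is a quaternionic structure), then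
`B† C B̄ = −σ(−1)^{t(t+1)/2} C̄` (bar denoting entrywise complex conjugation). -/
theorem stmt_18 (N : ℕ) (t : ℕ) (σ : ℂ) (hσ : σ = 1 ∨ σ = -1)
    (A C : Matrix (Fin N) (Fin N) ℂ) (hA : IsUnit A) (hC : IsUnit C)
    (hAdag : Aᴴ = ((-1 : ℂ) ^ (t * (t + 1) / 2)) • A)
    (hCsym : Cᵀ = σ • C)
    (B : Matrix (Fin N) (Fin N) ℂ) (hB : B = (C * A⁻¹)ᵀ)
    (hBB : B.map (starRingEnd ℂ) * B = -1) :
    Bᴴ * C * B.map (starRingEnd ℂ) =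
      (-σ * (-1 : ℂ) ^ (t * (t + 1) / 2)) • C.map (starRingEnd ℂ) := by
  have hdet : IsUnit A.det := (Matrix.isUnit_iff_isUnit_det A).mp hA
  have hCBA : C = Bᵀ * A := by
    rw [hB, transpose_transpose, Matrix.nonsing_inv_mul_cancel_right _ _ hdet]
  have hBt : Bᴴ * Bᵀ = -1 := by
    have h : Bᵀ * Bᴴ = -1 := by
      simpa [transpose_mul, conjTranspose, transpose_map] using congrArg transpose hBB
    have h' : Bᵀ * (-Bᴴ) = 1 := by rw [mul_neg, h, neg_neg]
    have h'' := mul_eq_one_comm.mp h'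
    rw [neg_mul] at h''
    rw [← h'', neg_neg]
  have hσconj : starRingEnd ℂ σ = σ := by
    rcases hσ with rfl | rfl <;> simp
  have hCdag : Cᴴ = σ • C.map (starRingEnd ℂ) := by
    have h : Cᴴ = (Cᵀ).map (starRingEnd ℂ) := rfl
    rw [h, hCsym]
    ext i j
    simp [hσconj]
  have hCdag' : Cᴴ = ((-1 : ℂ) ^ (t * (t + 1) / 2)) • (A * B.map (starRingEnd ℂ)) := by
    have h : (Bᵀ)ᴴ = B.map (starRingEnd ℂ) := rfl
    rw [hCBA, conjTranspose_mul, hAdag, h, smul_mul_assoc]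
  have hsq : (-1 : ℂ) ^ (t * (t + 1) / 2) * (-1 : ℂ) ^ (t * (t + 1) / 2) = 1 := by
    rw [← mul_pow]; simp
  have hAB : A * B.map (starRingEnd ℂ) =
      (σ * (-1 : ℂ) ^ (t * (t + 1) / 2)) • C.map (starRingEnd ℂ) := by
    rw [mul_comm σ, mul_smul, ← hCdag, hCdag', smul_smul, hsq, one_smul]
  have hBC : Bᴴ * C = -A := by
    rw [hCBA, ← Matrix.mul_assoc, hBt, neg_mul, one_mul]
  rw [hBC, neg_mul, hAB, neg_mul, neg_smul]
end
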